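/- The set 𝓔̃ coincides with the set {α ∈ [g,1] : T_1^n(α) ∉ (1/(α+1), α) for all n ≥ 2, and T_1^n(α) ∉ (1−α, α/(α+1)) for all n ≥ 2 such that P_n(α) is odd}, and also with the set {α ∈ [g,1] : T_1^n(α) ∉ (1−α, α/(α+1)) ∪ (1/(α+1), α) for all n ≥ 2 such that P_n(α) is odd}. -/

import Mathlib

open Set Filter MeasureTheory

/-- The Tanaka–Ito `α`-continued fraction map; `T 1` is the Gauss map. -/
noncomputable def T (α x : ℝ) : ℝ := if x = 0 then 0 else 1 / x - (⌊1 / x + 1 - α⌋ : ℝ)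

/-- The small golden mean `g = (√5 - 1)/2`. -/
noncomputable def g : ℝ := (Real.sqrt 5 - 1) / 2

/-- The set `𝓔̃` of parameters in `[g,1]` whose orbits stay below `1/(α+1)`. -/
noncomputable def Etilde : Set ℝ :=
  {α ∈ Set.Icc g 1 | ∀ n ≥ 1,
    (T α)^[n] (α - 1) ≤ 1 / (α + 1) ∧ (T α)^[n] (1 / α - 1) ≤ 1 / (α + 1)}

/-- `P n α = min {k ≥ 0 : T₁^{n-k}(α) ≤ 1 - α or T₁^{n-k-1}(α) ≥ α}`. -/
noncomputable def P (n : ℕ) (α : ℝ) : ℕ :=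
  sInf {k : ℕ | (T 1)^[n - k] α ≤ 1 - α ∨ α ≤ (T 1)^[n - k - 1] α}

/-! ### The two folded representatives of a point of the Gauss orbit -/

/-- The representative of `s` modulo `1` in `[α - 1, α)`, for `s ∈ [0, 1)`. -/
noncomputable def repA (α s : ℝ) : ℝ := if s < α then s else s - 1

/-- The representative of `-s` modulo `1` in `[α - 1, α)`, for `s ∈ [0, 1)`. -/
noncomputable def repB (α s : ℝ) : ℝ := if s ≤ 1 - α then -s else 1 - s

lemma T_zero (α : ℝ) : T α 0 = 0 := by simp [T]

lemma T_eq_of_sub_eq_int {α x z : ℝ} (hx : x ≠ 0) (h1 : α - 1 ≤ z) (h2 : z < α) (m : ℤ)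
    (h : 1 / x - z = m) : T α x = z := by
  have hm : ⌊1 / x + 1 - α⌋ = m := by
    rw [Int.floor_eq_iff]
    constructor <;> linarith
  rw [T, if_neg hx, hm]
  linarith

lemma T_eq_repA {α x s : ℝ} (hx : x ≠ 0) (h0 : 0 ≤ s) (h1 : s < 1) (hα : α ≤ 1) (hα0 : 0 < α)
    (m : ℤ) (h : 1 / x = m + s) : T α x = repA α s := by
  unfold repA
  split_ifs with hs
  · exact T_eq_of_sub_eq_int hx (by linarith) hs m (by linarith)
  · exact T_eq_of_sub_eq_int hx (by linarith) (by linarith) (m + 1) (by push_cast; linarith)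

lemma T_eq_repB {α x s : ℝ} (hx : x ≠ 0) (h0 : 0 ≤ s) (h1 : s < 1) (hα : α ≤ 1) (hα0 : 0 < α)
    (m : ℤ) (h : 1 / x = m - s) : T α x = repB α s := by
  unfold repB
  split_ifs with hs
  · exact T_eq_of_sub_eq_int hx (by linarith) (by linarith) m (by linarith)
  · exact T_eq_of_sub_eq_int hx (by linarith) (by linarith) (m - 1) (by push_cast; linarith)

lemma gauss_mem (x : ℝ) : 0 ≤ T 1 x ∧ T 1 x < 1 := by
  unfold T
  split_ifs
  · norm_num
  · have h1 := Int.floor_le (1 / x + 1 - 1)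
    have h2 := Int.lt_floor_add_one (1 / x + 1 - 1)
    constructor <;> linarith

lemma gauss_spec {x : ℝ} (hx : x ≠ 0) : ∃ m : ℤ, 1 / x = m + T 1 x :=
  ⟨⌊1 / x + 1 - 1⌋, by rw [T, if_neg hx]; ring⟩

lemma gauss_of_half_lt {t : ℝ} (h : 1 / 2 < t) (h1 : t ≤ 1) : T 1 t = 1 / t - 1 := by
  have ht : 0 < t := by linarith
  have h2 : 1 / t < 2 := by rw [div_lt_iff₀ ht]; linarith
  have h3 : 1 ≤ 1 / t := by rw [le_div_iff₀ ht]; linarith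
  exact T_eq_of_sub_eq_int ht.ne' (by linarith) (by linarith) 1 (by push_cast; ring)

lemma gauss_of_third_lt {t : ℝ} (h : 1 / 3 < t) (h1 : t ≤ 1 / 2) : T 1 t = 1 / t - 2 := by
  have ht : 0 < t := by linarith
  have h2 : 1 / t < 3 := by rw [div_lt_iff₀ ht]; linarith
  have h3 : 2 ≤ 1 / t := by rw [le_div_iff₀ ht]; linarith
  exact T_eq_of_sub_eq_int ht.ne' (by linarith) (by linarith) 2 (by push_cast; ring)

/-! ### One step of `T α` in terms of the Gauss map -/

section Dynamics

variable {α t : ℝ}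

lemma T_self (hα0 : 0 < α) (hα : α ≤ 1) (t : ℝ) : T α t = repA α (T 1 t) := by
  rcases eq_or_ne t 0 with rfl | ht
  · simp [T_zero, repA, hα0]
  · obtain ⟨m, hm⟩ := gauss_spec ht
    exact T_eq_repA ht (gauss_mem t).1 (gauss_mem t).2 hα hα0 m hm

lemma T_neg (hα0 : 0 < α) (hα : α ≤ 1) (t : ℝ) : T α (-t) = repB α (T 1 t) := by
  rcases eq_or_ne t 0 with rfl | ht
  · simp [T_zero, repB, hα]
  · obtain ⟨m, hm⟩ := gauss_spec ht
    refine T_eq_repB (neg_ne_zero.2 ht) (gauss_mem t).1 (gauss_mem t).2 hα hα0 (-m) ?_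
    rw [one_div_neg_eq_neg_one_div, hm]
    push_cast
    ring

lemma exists_one_div_one_sub (h : 1 / 2 < t) (h1 : t < 1) :
    ∃ m : ℤ, 1 / (1 - t) = m + T 1 (T 1 t) := by
  have ht : 0 < t := by linarith
  have ht1 : 0 < 1 - t := by linarith
  have hG := gauss_of_half_lt h h1.le
  have hG' : T 1 t = (1 - t) / t := by rw [hG]; field_simp
  obtain ⟨m, hm⟩ := gauss_spec (x := T 1 t) (by rw [hG']; positivity)
  refine ⟨m + 1, ?_⟩
  have : 1 / (1 - t) = 1 / T 1 t + 1 := by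
    rw [hG']
    field_simp
    ring
  rw [this, hm]
  push_cast
  ring

lemma T_sub_one (hα0 : 0 < α) (hα : α ≤ 1) (h : 1 / 2 < t) (h1 : t < 1) :
    T α (t - 1) = repB α (T 1 (T 1 t)) := by
  obtain ⟨m, hm⟩ := exists_one_div_one_sub h h1
  refine T_eq_repB (by linarith) (gauss_mem _).1 (gauss_mem _).2 hα hα0 (-m) ?_
  rw [← neg_sub 1 t, one_div_neg_eq_neg_one_div, hm]
  push_cast
  ring

lemma T_one_sub (hα0 : 0 < α) (hα : α ≤ 1) (h : 1 / 2 < t) (h1 : t < 1) :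
    T α (1 - t) = repA α (T 1 (T 1 t)) := by
  obtain ⟨m, hm⟩ := exists_one_div_one_sub h h1
  exact T_eq_repA (by linarith) (gauss_mem _).1 (gauss_mem _).2 hα hα0 m hm

lemma T_one_sub_of_le_half (hα0 : 0 < α) (hl : α / (α + 1) ≤ t) (h : t ≤ 1 / 2) :
    T α (1 - t) = t / (1 - t) - 1 := by
  have h1 : 0 < 1 - t := by linarith
  have hl' : α ≤ t * (α + 1) := (div_le_iff₀ (by linarith)).1 hl
  have h2 : α ≤ t / (1 - t) := by rw [le_div_iff₀ h1]; linarith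
  have h3 : t / (1 - t) ≤ 1 := by rw [div_le_iff₀ h1]; linarith
  refine T_eq_of_sub_eq_int h1.ne' (by linarith) (by linarith) 2 ?_
  push_cast
  field_simp
  ring

lemma T_T_one_sub (hα0 : 1 / 2 < α) (hα : α ≤ 1) (hl : α / (α + 1) ≤ t) (h : t ≤ 1 / 2) :
    T α (T α (1 - t)) = repB α (T 1 (T 1 t)) := by
  have hα00 : 0 < α := by linarith
  have hl' : α ≤ t * (α + 1) := (div_le_iff₀ (by linarith)).1 hl
  have h3 : 1 / 3 < t := by nlinarith
  rw [T_one_sub_of_le_half hα00 hl h]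
  have hG := gauss_of_third_lt h3 h
  rcases h.eq_or_lt with rfl | h
  · norm_num at hG
    rw [hG, T_zero]
    norm_num [T_zero, repB, hα]
  have ht : 0 < t := by linarith
  have h1 : 0 < 1 - t := by linarith
  have h2 : 0 < 1 - 2 * t := by linarith
  have hG' : T 1 t = (1 - 2 * t) / t := by rw [hG]; field_simp
  obtain ⟨m, hm⟩ := gauss_spec (x := T 1 t) (by rw [hG']; positivity)
  have hz : t / (1 - t) - 1 = -((1 - 2 * t) / (1 - t)) := by
    field_simp
    ring
  rw [hz]
  refine T_eq_repB (neg_ne_zero.2 (by positivity)) (gauss_mem _).1 (gauss_mem _).2 hα hα00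
    (-m - 1) ?_
  have : 1 / -((1 - 2 * t) / (1 - t)) = -(1 / T 1 t) - 1 := by
    rw [hG', one_div_neg_eq_neg_one_div]
    field_simp
    ring
  rw [this, hm]
  push_cast
  ring

lemma repA_of_lt (h : t < α) : repA α t = t := if_pos h

lemma repA_of_ge (h : α ≤ t) : repA α t = t - 1 := if_neg h.not_gt

lemma repB_of_le (h : t ≤ 1 - α) : repB α t = -t := if_pos h

lemma repB_of_gt (h : 1 - α < t) : repB α t = 1 - t := if_neg h.not_ge

lemma gauss_lt_of_ge (hg : 1 < α ^ 2 + α) (hα0 : 1 / 2 < α) (h : α ≤ t) (h1 : t ≤ 1) :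
    T 1 t < α := by
  rw [gauss_of_half_lt (by linarith) h1, sub_lt_iff_lt_add, div_lt_iff₀ (by linarith)]
  nlinarith

lemma gauss_le_of_ge (hg : 1 ≤ α ^ 2 + α) (hα0 : 1 / 2 < α) (h : α ≤ t) (h1 : t ≤ 1) :
    T 1 t ≤ 1 / (α + 1) := by
  rw [gauss_of_half_lt (by linarith) h1, sub_le_iff_le_add, div_le_iff₀ (by linarith)]
  have : 1 / (α + 1) + 1 = (α + 2) / (α + 1) := by field_simp; ring
  rw [this, div_mul_eq_mul_div, le_div_iff₀ (by linarith)]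
  nlinarith

lemma gauss_lt_of_lower (hg : 1 < α ^ 2 + α) (hα0 : 1 / 2 < α) (hl : α / (α + 1) ≤ t)
    (h : t ≤ 1 / 2) : T 1 t < α := by
  have hl' : α ≤ t * (α + 1) := (div_le_iff₀ (by linarith)).1 hl
  have h3 : 1 / 3 < t := by nlinarith
  rw [gauss_of_third_lt h3 h, sub_lt_iff_lt_add, div_lt_iff₀ (by linarith)]
  by_contra! hc
  nlinarith

lemma gauss_le_of_lower (hg : 1 ≤ α ^ 2 + α) (hα0 : 1 / 2 < α) (hl : α / (α + 1) ≤ t)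
    (h : t ≤ 1 / 2) : T 1 t ≤ 1 / (α + 1) := by
  have hl' : α ≤ t * (α + 1) := (div_le_iff₀ (by linarith)).1 hl
  have h3 : 1 / 3 < t := by nlinarith
  have h4 : 1 / t ≤ (α + 1) / α := by
    rw [div_le_div_iff₀ (by linarith) (by linarith)]; linarith
  have h5 : (α + 1) / α - 2 ≤ 1 / (α + 1) := by
    rw [sub_le_iff_le_add, div_add' _ _ _ (by linarith),
      div_le_div_iff₀ (by linarith) (by linarith)]
    nlinarith
  rw [gauss_of_third_lt h3 h]
  linarith

lemma le_gauss_of_upper (hα0 : 1 / 2 < α) (h : 1 / 2 < t) (hu : t ≤ 1 / (α + 1)) :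
    α ≤ T 1 t := by
  have hu' : t * (α + 1) ≤ 1 := (le_div_iff₀ (by linarith)).1 hu
  rw [gauss_of_half_lt h (by nlinarith), le_sub_iff_add_le, le_div_iff₀ (by linarith)]
  linarith

/-! ### Points whose orbit stays below the threshold -/

/-- The first `N` points of the `T α`-orbit of `x` are at most `1 / (α + 1)`. -/
def StaysBelow (α : ℝ) (N : ℕ) (x : ℝ) : Prop := ∀ k < N, (T α)^[k] x ≤ 1 / (α + 1)

lemma staysBelow_succ {N : ℕ} {x : ℝ} :
    StaysBelow α (N + 1) x ↔ x ≤ 1 / (α + 1) ∧ StaysBelow α N (T α x) := by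
  constructor
  · exact fun h => ⟨h 0 N.succ_pos, fun k hk => h (k + 1) (by omega)⟩
  · rintro ⟨h0, h⟩ (_ | k) hk
    · exact h0
    · exact h k (by omega)

/-- Both folded representatives of `t` have their first `N` iterates below the threshold. -/
def BothBelow (α : ℝ) (N : ℕ) (t : ℝ) : Prop :=
  StaysBelow α N (repA α t) ∧ StaysBelow α N (repB α t)

lemma BothBelow.mono {M N : ℕ} (hMN : M ≤ N) (h : BothBelow α N t) : BothBelow α M t :=
  ⟨fun k hk => h.1 k (by omega), fun k hk => h.2 k (by omega)⟩

lemma bothBelow_succ_of_le (hg : 1 ≤ α ^ 2 + α) (hα0 : 1 / 2 < α) (hα : α ≤ 1) (h0 : 0 ≤ t)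
    (h : t ≤ 1 - α) (N : ℕ) : BothBelow α (N + 1) t ↔ BothBelow α N (T 1 t) := by
  have hp : 0 < 1 / (α + 1) := one_div_pos.2 (by linarith)
  have hc : t ≤ 1 / (α + 1) := by
    rw [le_div_iff₀ (by linarith)]
    nlinarith
  have hn : -t ≤ 1 / (α + 1) := by linarith
  unfold BothBelow
  rw [repA_of_lt (by linarith), repB_of_le h, staysBelow_succ, staysBelow_succ,
    T_self (by linarith) hα, T_neg (by linarith) hα]
  tauto

lemma bothBelow_succ_of_ge (hg : 1 ≤ α ^ 2 + α) (hα0 : 1 / 2 < α) (hα : α ≤ 1) (h : α ≤ t)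
    (h1 : t < 1) (N : ℕ) : BothBelow α (N + 1) t ↔ BothBelow α N (T 1 (T 1 t)) := by
  have hp : 0 < 1 / (α + 1) := one_div_pos.2 (by linarith)
  have hc : 1 - t ≤ 1 / (α + 1) := by
    rw [le_div_iff₀ (by linarith)]
    nlinarith
  have hn : t - 1 ≤ 1 / (α + 1) := by linarith
  unfold BothBelow
  rw [repA_of_ge h, repB_of_gt (by linarith), staysBelow_succ, staysBelow_succ,
    T_sub_one (by linarith) hα (by linarith) h1, T_one_sub (by linarith) hα (by linarith) h1]
  tauto

lemma one_sub_le_iff (hα0 : 1 / 2 < α) : 1 - t ≤ 1 / (α + 1) ↔ α / (α + 1) ≤ t := by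
  have : α / (α + 1) = 1 - 1 / (α + 1) := by field_simp; ring
  rw [this]
  constructor <;> intro <;> linarith

lemma BothBelow.bounds (hα0 : 1 / 2 < α) {N : ℕ} (hl : 1 - α < t) (hu : t < α)
    (h : BothBelow α (N + 1) t) : α / (α + 1) ≤ t ∧ t ≤ 1 / (α + 1) := by
  unfold BothBelow at h
  rw [repA_of_lt hu, repB_of_gt hl, staysBelow_succ, staysBelow_succ, one_sub_le_iff hα0] at h
  exact ⟨h.2.1, h.1.1⟩

lemma bothBelow_add_two_of_lower (hg : 1 < α ^ 2 + α) (hα0 : 1 / 2 < α) (hα : α ≤ 1)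
    (hl : 1 - α < t) (hu : t < α) (h1 : α / (α + 1) ≤ t) (h2 : t ≤ 1 / (α + 1)) (h : t ≤ 1 / 2)
    (N : ℕ) : BothBelow α (N + 2) t ↔ BothBelow α N (T 1 (T 1 t)) := by
  have hp : 0 < 1 / (α + 1) := one_div_pos.2 (by linarith)
  have hG := gauss_lt_of_lower hg hα0 h1 h
  have hG' := gauss_le_of_lower hg.le hα0 h1 h
  have h1' := (one_sub_le_iff hα0).2 h1
  have hB : T α (1 - t) ≤ 1 / (α + 1) := by
    rw [T_one_sub_of_le_half (by linarith) h1 h]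
    have : t / (1 - t) ≤ 1 := by rw [div_le_one (by linarith)]; linarith
    linarith
  unfold BothBelow
  simp only [staysBelow_succ]
  rw [repA_of_lt hu, repB_of_gt hl, T_T_one_sub hα0 hα h1 h, T_self (by linarith) hα t,
    repA_of_lt hG, T_self (by linarith) hα]
  tauto

lemma bothBelow_add_two_of_upper (hg : 1 < α ^ 2 + α) (hα0 : 1 / 2 < α) (hα : α ≤ 1)
    (hl : 1 - α < t) (hu : t < α) (h1 : α / (α + 1) ≤ t) (h2 : t ≤ 1 / (α + 1)) (h : 1 / 2 < t)
    (N : ℕ) : BothBelow α (N + 2) t ↔ BothBelow α N (T 1 (T 1 (T 1 t))) := by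
  have hp : 0 < 1 / (α + 1) := one_div_pos.2 (by linarith)
  have hG := le_gauss_of_upper hα0 h h2
  have hG1 := (gauss_mem t).2
  have hGG := gauss_lt_of_ge hg hα0 hG hG1.le
  have hGG' := gauss_le_of_ge hg.le hα0 hG hG1.le
  have h1' := (one_sub_le_iff hα0).2 h1
  have hn : T 1 t - 1 ≤ 1 / (α + 1) := by linarith
  unfold BothBelow
  simp only [staysBelow_succ]
  rw [repA_of_lt hu, repB_of_gt hl, T_one_sub (by linarith) hα h (by linarith),
    T_self (by linarith) hα t, repA_of_ge hG, T_sub_one (by linarith) hα (by linarith) hG1, repA_of_lt hGG,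
    T_self (by linarith) hα]
  tauto

end Dynamics

/-! ### The counter `P` -/

section Counter

variable {α : ℝ} {n : ℕ}

lemma P_one (α : ℝ) : P 1 α = 0 := by
  unfold P
  rw [Nat.sInf_eq_zero]
  left
  right
  simp

lemma P_succ_eq_zero (h : (T 1)^[n + 1] α ≤ 1 - α ∨ α ≤ (T 1)^[n] α) : P (n + 1) α = 0 := by
  unfold P
  rw [Nat.sInf_eq_zero]
  left
  simpa using h

lemma P_succ_eq_add_one (hn : 1 ≤ n) (h1 : 1 - α < (T 1)^[n + 1] α) (h2 : (T 1)^[n] α < α) :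
    P (n + 1) α = P n α + 1 := by
  have hmem : ∀ k, (T 1)^[n + 1 - (k + 1)] α ≤ 1 - α ∨ α ≤ (T 1)^[n + 1 - (k + 1) - 1] α ↔
      (T 1)^[n - k] α ≤ 1 - α ∨ α ≤ (T 1)^[n - k - 1] α := by
    intro k
    rw [Nat.add_sub_add_right]
  have hne : {k : ℕ | (T 1)^[n - k] α ≤ 1 - α ∨ α ≤ (T 1)^[n - k - 1] α}.Nonempty :=
    ⟨n - 1, Or.inr (by rw [show n - (n - 1) - 1 = 0 by omega]; simp)⟩
  refine IsLeast.csInf_eq ⟨(hmem _).2 (Nat.sInf_mem hne), ?_⟩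
  rintro (_ | k) hk
  · rcases hk with hk | hk
    · exact absurd hk (by simpa using h1)
    · exact absurd hk (by simpa using h2)
  · exact Nat.succ_le_succ (Nat.sInf_le ((hmem k).1 hk))

lemma lt_of_odd_P (hn : 2 ≤ n) (h : Odd (P n α)) : 1 - α < (T 1)^[n] α := by
  by_contra! hc
  obtain ⟨m, rfl⟩ : ∃ m, n = m + 1 := ⟨n - 1, by omega⟩
  rw [P_succ_eq_zero (.inl hc)] at h
  simp at h

lemma two_le_of_odd_P (hn : 1 ≤ n) (h : Odd (P n α)) : 2 ≤ n := by
  rcases hn.eq_or_lt with rfl | hn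
  · simp [P_one] at h
  · exact hn

end Counter

/-! ### Comparing the orbits -/

section Orbit

variable {α : ℝ} {n : ℕ}

lemma iterate_mem (hn : 1 ≤ n) (α : ℝ) : 0 ≤ (T 1)^[n] α ∧ (T 1)^[n] α < 1 := by
  obtain ⟨m, rfl⟩ : ∃ m, n = m + 1 := ⟨n - 1, by omega⟩
  rw [Function.iterate_succ_apply']
  exact gauss_mem _

lemma iterate_succ_eq (n : ℕ) : (T 1)^[n + 1] α = T 1 ((T 1)^[n] α) :=
  Function.iterate_succ_apply' _ _ _

lemma iterate_add_two_eq (n : ℕ) : (T 1)^[n + 2] α = T 1 (T 1 ((T 1)^[n] α)) := by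
  rw [iterate_succ_eq, iterate_succ_eq]

lemma iterate_add_three_eq (n : ℕ) :
    (T 1)^[n + 3] α = T 1 (T 1 (T 1 ((T 1)^[n] α))) := by
  rw [iterate_succ_eq, iterate_succ_eq, iterate_succ_eq]

lemma mem_Etilde_iff_bothBelow (hg : 1 ≤ α ^ 2 + α) (hα0 : 1 / 2 < α) (hα : α ≤ 1) :
    (∀ n ≥ 1, (T α)^[n] (α - 1) ≤ 1 / (α + 1) ∧ (T α)^[n] (1 / α - 1) ≤ 1 / (α + 1)) ↔
      ∀ N, BothBelow α N ((T 1)^[2] α) := by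
  have e1 : T α (α - 1) = repB α ((T 1)^[2] α) := by
    rw [iterate_add_two_eq 0]
    rcases hα.eq_or_lt with rfl | h1
    · have : T 1 1 = 0 := by rw [gauss_of_half_lt (by norm_num) le_rfl]; norm_num
      simp [this, T_zero, repB]
    · exact T_sub_one (by linarith) hα hα0 h1
  have e2 : T α (1 / α - 1) = repA α ((T 1)^[2] α) := by
    rw [T_self (by linarith) hα, ← gauss_of_half_lt hα0 hα, iterate_add_two_eq 0]
    rfl
  constructor
  · intro h N
    constructor
    · intro k _
      have := (h (k + 1) (by omega)).2
      rwa [Function.iterate_succ_apply, e2] at this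
    · intro k _
      have := (h (k + 1) (by omega)).1
      rwa [Function.iterate_succ_apply, e1] at this
  · intro h n hn
    obtain ⟨m, rfl⟩ : ∃ m, n = m + 1 := ⟨n - 1, by omega⟩
    rw [Function.iterate_succ_apply, Function.iterate_succ_apply, e1, e2]
    exact ⟨(h (m + 1)).2 m (by omega), (h (m + 1)).1 m (by omega)⟩

/-- At odd times both orbits are present; at even times they meet at the next time, or two
steps later if the Gauss orbit is above `α`. -/
lemma bothBelow_of_parity (hg : 1 < α ^ 2 + α) (hα0 : 1 / 2 < α) (hα : α ≤ 1)
    (h : ∀ N, BothBelow α N ((T 1)^[2] α)) (hn : 1 ≤ n) :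
    (Odd (P n α) → ∀ N, BothBelow α N ((T 1)^[n] α)) ∧
    (Even (P n α) → ((T 1)^[n] α < α ∧ ∀ N, BothBelow α N ((T 1)^[n + 1] α)) ∨
      (α ≤ (T 1)^[n] α ∧ ∀ N, BothBelow α N ((T 1)^[n + 2] α))) := by
  induction n, hn using Nat.le_induction with
  | base =>
    refine ⟨fun ho => by simp [P_one] at ho, fun _ => .inl ⟨?_, h⟩⟩
    exact gauss_lt_of_ge hg hα0 le_rfl hα
  | succ n hn ih =>
    obtain ⟨ih1, ih2⟩ := ih
    obtain ⟨ht0, ht1⟩ := iterate_mem hn α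
    rcases le_or_gt α ((T 1)^[n] α) with hge | hlt
    · rw [P_succ_eq_zero (.inr hge)]
      refine ⟨fun ho => by simp at ho, fun _ => .inl ⟨?_, ?_⟩⟩
      · rw [iterate_succ_eq]
        exact gauss_lt_of_ge hg hα0 hge ht1.le
      · rcases Nat.even_or_odd (P n α) with he | ho
        · exact ((ih2 he).resolve_left fun h => h.1.not_ge hge).2
        · intro N
          rw [iterate_add_two_eq]
          exact (bothBelow_succ_of_ge hg.le hα0 hα hge ht1 N).1 (ih1 ho _)
    -- the behaviour after an odd time below `α`
    have key : Odd (P n α) →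
        ((T 1)^[n + 1] α < α ∧ ∀ N, BothBelow α N ((T 1)^[n + 2] α)) ∨
        (α ≤ (T 1)^[n + 1] α ∧ ∀ N, BothBelow α N ((T 1)^[n + 3] α)) := by
      intro ho
      have hl := lt_of_odd_P (two_le_of_odd_P hn ho) ho
      obtain ⟨hb1, hb2⟩ := (ih1 ho 1).bounds hα0 hl hlt
      rcases le_or_gt ((T 1)^[n] α) (1 / 2) with hh | hh
      · refine .inl ⟨?_, fun N => ?_⟩
        · rw [iterate_succ_eq]
          exact gauss_lt_of_lower hg hα0 hb1 hh
        · rw [iterate_add_two_eq]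
          exact (bothBelow_add_two_of_lower hg hα0 hα hl hlt hb1 hb2 hh N).1 (ih1 ho _)
      · refine .inr ⟨?_, fun N => ?_⟩
        · rw [iterate_succ_eq]
          exact le_gauss_of_upper hα0 hh hb2
        · rw [iterate_add_three_eq]
          exact (bothBelow_add_two_of_upper hg hα0 hα hl hlt hb1 hb2 hh N).1 (ih1 ho _)
    rcases le_or_gt ((T 1)^[n + 1] α) (1 - α) with hle | hgt
    · rw [P_succ_eq_zero (.inl hle)]
      refine ⟨fun ho => by simp at ho, fun _ => ?_⟩
      rcases Nat.even_or_odd (P n α) with he | ho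
      · refine .inl ⟨by linarith, fun N => ?_⟩
        rw [iterate_succ_eq]
        exact (bothBelow_succ_of_le hg.le hα0 hα (iterate_mem (by omega) α).1 hle N).1
          (((ih2 he).resolve_right fun h => h.1.not_gt hlt).2 _)
      · exact key ho
    · rw [P_succ_eq_add_one hn hgt hlt]
      refine ⟨fun ho => ?_, fun he => key (by simpa [parity_simps] using he)⟩
      have he : Even (P n α) := by simpa [parity_simps] using ho
      exact ((ih2 he).resolve_right fun h => h.1.not_gt hlt).2

/-- The conditions at odd times propagate to the orbits of both representatives. -/
lemma bothBelow_of_forall_odd (hg : 1 < α ^ 2 + α) (hα0 : 1 / 2 < α) (hα : α ≤ 1)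
    (h : ∀ n ≥ 2, Odd (P n α) →
      (T 1)^[n] α ∉ Ioo (1 - α) (α / (α + 1)) ∪ Ioo (1 / (α + 1)) α) (N : ℕ) :
    ∀ n ≥ 2, ((T 1)^[n] α ≤ 1 - α ∨ Odd (P n α)) → BothBelow α N ((T 1)^[n] α) := by
  induction N with
  | zero => exact fun n _ _ => ⟨fun k hk => by omega, fun k hk => by omega⟩
  | succ N ih =>
    intro n hn hcond
    obtain ⟨ht0, ht1⟩ := iterate_mem (n := n) (by omega) α
    -- an even time below `α` is followed by a meeting time
    have next : ∀ m ≥ 1, Even (P m α) → (T 1)^[m] α < α →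
        ((T 1)^[m + 1] α ≤ 1 - α ∨ Odd (P (m + 1) α)) := by
      intro m hm he hlt
      rcases le_or_gt ((T 1)^[m + 1] α) (1 - α) with hle | hgt
      · exact .inl hle
      · right
        rw [P_succ_eq_add_one hm hgt hlt]
        exact he.add_one
    rcases le_or_gt ((T 1)^[n] α) (1 - α) with hle | hgt
    · have hP : P n α = 0 := by
        obtain ⟨m, rfl⟩ : ∃ m, n = m + 1 := ⟨n - 1, by omega⟩
        exact P_succ_eq_zero (.inl hle)
      rw [bothBelow_succ_of_le hg.le hα0 hα ht0 hle, ← iterate_succ_eq]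
      exact ih _ (by omega) (next n (by omega) (by simp [hP]) (by linarith))
    rcases le_or_gt α ((T 1)^[n] α) with hge | hlt
    · rw [bothBelow_succ_of_ge hg.le hα0 hα hge ht1, ← iterate_add_two_eq]
      refine ih _ (by omega) (next (n + 1) (by omega) ?_ ?_)
      · rw [P_succ_eq_zero (.inr hge)]
        exact Even.zero
      · rw [iterate_succ_eq]
        exact gauss_lt_of_ge hg hα0 hge ht1.le
    have ho := hcond.resolve_left hgt.not_ge
    have hbad := h n hn ho
    have hb1 : α / (α + 1) ≤ (T 1)^[n] α := not_lt.1 fun hc => hbad (.inl ⟨hgt, hc⟩)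
    have hb2 : (T 1)^[n] α ≤ 1 / (α + 1) := not_lt.1 fun hc => hbad (.inr ⟨hc, hlt⟩)
    rcases le_or_gt ((T 1)^[n] α) (1 / 2) with hh | hh
    · refine BothBelow.mono (N := N + 2) (by omega) ?_
      rw [bothBelow_add_two_of_lower hg hα0 hα hgt hlt hb1 hb2 hh, ← iterate_add_two_eq]
      refine ih _ (by omega) (next (n + 1) (by omega) ?_ ?_)
      · rcases le_or_gt ((T 1)^[n + 1] α) (1 - α) with hle | hgt'
        · rw [P_succ_eq_zero (.inl hle)]
          exact Even.zero
        · rw [P_succ_eq_add_one (by omega) hgt' hlt]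
          exact ho.add_one
      · rw [iterate_succ_eq]
        exact gauss_lt_of_lower hg hα0 hb1 hh
    · refine BothBelow.mono (N := N + 2) (by omega) ?_
      rw [bothBelow_add_two_of_upper hg hα0 hα hgt hlt hb1 hb2 hh, ← iterate_add_three_eq]
      have hge : α ≤ (T 1)^[n + 1] α := by
        rw [iterate_succ_eq]
        exact le_gauss_of_upper hα0 hh hb2
      refine ih _ (by omega) (next (n + 2) (by omega) ?_ ?_)
      · rw [P_succ_eq_zero (.inr hge)]
        exact Even.zero
      · rw [iterate_succ_eq]
        exact gauss_lt_of_ge hg hα0 hge (iterate_mem (by omega) α).2.le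

/-- The upper gap is avoided at all times as soon as both gaps are avoided at odd times. -/
lemma notMem_upper_of_forall_odd (hg : 1 ≤ α ^ 2 + α) (hα0 : 1 / 2 < α)
    (h : ∀ n ≥ 2, Odd (P n α) →
      (T 1)^[n] α ∉ Ioo (1 - α) (α / (α + 1)) ∪ Ioo (1 / (α + 1)) α) (hn : 2 ≤ n) :
    (T 1)^[n] α ∉ Ioo (1 / (α + 1)) α := by
  rintro ⟨h1, h2⟩
  rcases Nat.even_or_odd (P n α) with he | ho
  swap
  · exact h n hn ho (.inr ⟨h1, h2⟩)
  obtain ⟨m, rfl⟩ : ∃ m, n = m + 1 := ⟨n - 1, by omega⟩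
  have hm : 1 ≤ m := by omega
  obtain ⟨ht0, ht1⟩ := iterate_mem hm α
  rw [iterate_succ_eq] at h1 h2
  rcases le_or_gt α ((T 1)^[m] α) with hge | hlt
  · exact h1.not_ge (gauss_le_of_ge hg hα0 hge ht1.le)
  have hgt : 1 - α < (T 1)^[m + 1] α := by
    rw [iterate_succ_eq]
    refine lt_of_le_of_lt ?_ h1
    rw [le_div_iff₀ (by linarith)]
    nlinarith
  rw [P_succ_eq_add_one hm hgt hlt] at he
  have ho : Odd (P m α) := by simpa [parity_simps] using he
  have hm2 := two_le_of_odd_P hm ho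
  have hl := lt_of_odd_P hm2 ho
  have hbad := h m hm2 ho
  have hb1 : α / (α + 1) ≤ (T 1)^[m] α := not_lt.1 fun hc => hbad (.inl ⟨hl, hc⟩)
  have hb2 : (T 1)^[m] α ≤ 1 / (α + 1) := not_lt.1 fun hc => hbad (.inr ⟨hc, hlt⟩)
  rcases le_or_gt ((T 1)^[m] α) (1 / 2) with hh | hh
  · exact h1.not_ge (gauss_le_of_lower hg hα0 hb1 hh)
  · exact h2.not_ge (le_gauss_of_upper hα0 hh hb2)

/-- At the golden mean the Gauss orbit is constant. -/
lemma iterate_of_golden (hg : α ^ 2 + α = 1) (hα0 : 1 / 2 < α) (hα : α ≤ 1) (n : ℕ) :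
    (T 1)^[n] α = α := by
  refine Function.iterate_fixed ?_ n
  rw [gauss_of_half_lt hα0 hα, sub_eq_iff_eq_add, div_eq_iff (by linarith)]
  linarith

lemma bothBelow_of_golden (hg : α ^ 2 + α = 1) (hα0 : 1 / 2 < α) (hα : α < 1) (N : ℕ) :
    BothBelow α N α := by
  induction N with
  | zero => exact ⟨fun k hk => by omega, fun k hk => by omega⟩
  | succ N ih =>
    have hfix : T 1 α = α := iterate_of_golden hg hα0 hα.le 1
    rwa [bothBelow_succ_of_ge hg.ge hα0 hα.le le_rfl hα, hfix, hfix]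

lemma bounds_of_mem_Icc (h : α ∈ Icc g 1) : 1 / 2 < α ∧ 1 ≤ α ^ 2 + α := by
  have hs : Real.sqrt 5 ^ 2 = 5 := Real.sq_sqrt (by norm_num)
  have hs2 : 2 < Real.sqrt 5 := Real.lt_sqrt_of_sq_lt (by norm_num)
  have hgα : (Real.sqrt 5 - 1) / 2 ≤ α := h.1
  constructor <;> nlinarith

lemma mem_Etilde_iff_forall_odd (h : α ∈ Icc g 1) :
    (∀ n ≥ 1, (T α)^[n] (α - 1) ≤ 1 / (α + 1) ∧ (T α)^[n] (1 / α - 1) ≤ 1 / (α + 1)) ↔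
      ∀ n ≥ 2, Odd (P n α) →
        (T 1)^[n] α ∉ Ioo (1 - α) (α / (α + 1)) ∪ Ioo (1 / (α + 1)) α := by
  obtain ⟨hα0, hg⟩ := bounds_of_mem_Icc h
  have hα := h.2
  rw [mem_Etilde_iff_bothBelow hg hα0 hα]
  rcases hg.eq_or_lt with hg | hg
  · have hα1 : α < 1 := by nlinarith
    simp only [iterate_of_golden hg.symm hα0 hα]
    refine iff_of_true (bothBelow_of_golden hg.symm hα0 hα1) fun n _ _ => ?_
    rintro (⟨_, h2⟩ | ⟨_, h2⟩)
    · rw [lt_div_iff₀ (by linarith)] at h2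
      nlinarith
    · exact h2.false
  constructor
  · intro hB n hn ho
    have hl := lt_of_odd_P hn ho
    have hn' := (bothBelow_of_parity hg hα0 hα hB (by omega : 1 ≤ n)).1 ho 1
    have hac : α / (α + 1) < α := by
      rw [div_lt_iff₀ (by linarith)]
      nlinarith
    rintro (⟨_, h2⟩ | ⟨h1, h2⟩)
    · exact h2.not_ge (hn'.bounds hα0 hl (h2.trans hac)).1
    · exact h1.not_ge (hn'.bounds hα0 hl h2).2
  · intro hodd N
    refine bothBelow_of_forall_odd hg hα0 hα hodd N 2 le_rfl ?_
    rcases le_or_gt ((T 1)^[2] α) (1 - α) with hle | hgt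
    · exact .inl hle
    · right
      rw [P_succ_eq_add_one le_rfl hgt (gauss_lt_of_ge hg hα0 le_rfl hα), P_one]
      exact odd_one

end Orbit

theorem stmt7 :
    Etilde = {α ∈ Set.Icc g 1 |
        (∀ n ≥ 2, (T 1)^[n] α ∉ Set.Ioo (1 / (α + 1)) α) ∧
        (∀ n ≥ 2, Odd (P n α) → (T 1)^[n] α ∉ Set.Ioo (1 - α) (α / (α + 1)))} ∧
    Etilde = {α ∈ Set.Icc g 1 |
        ∀ n ≥ 2, Odd (P n α) →
          (T 1)^[n] α ∉ Set.Ioo (1 - α) (α / (α + 1)) ∪ Set.Ioo (1 / (α + 1)) α} := by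
  have h2 : Etilde = {α ∈ Set.Icc g 1 |
        ∀ n ≥ 2, Odd (P n α) →
          (T 1)^[n] α ∉ Set.Ioo (1 - α) (α / (α + 1)) ∪ Set.Ioo (1 / (α + 1)) α} := by
    ext α
    exact and_congr_right mem_Etilde_iff_forall_odd
  refine ⟨?_, h2⟩
  rw [h2]
  ext α
  refine and_congr_right fun h => ⟨fun hodd => ⟨fun n hn => ?_, fun n hn ho hm => ?_⟩, ?_⟩
  · obtain ⟨hα0, hg⟩ := bounds_of_mem_Icc h
    exact notMem_upper_of_forall_odd hg hα0 hodd hn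
  · exact hodd n hn ho (.inl hm)
  · rintro ⟨hu, hl⟩ n hn ho (hm | hm)
    · exact hl n hn ho hm
    · exact hu n hn hm
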